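/- (Linear convergence of mS2GD.) Fix m ≥ 1, b ∈ {1,…,n}, and a stepsize h with 0 < h ≤ 1/L and 4hLα(b) < 1, where α(b) = (n−b)/(b(n−1)), and assume ρ < 1, where ρ = 1/( m·h·μ·(1 − 4hLα(b)) ) + 4hLα(b)·(m+1) / ( m·(1 − 4hLα(b)) ). Let (A_{k,t})_{k≥0, 0≤t<m} be mutually independent subsets of {1,…,n}, each of cardinality b and uniform among such subsets, and let (T_k)_{k≥0} be mutually independent, uniform on {1,…,m}, and independent of the A_{k,t}. Given x_0 ∈ ℝ^d, define for each k: y_{k,0} = x_k; for t = 0,…,m−1, y_{k,t+1} = prox_{hR}( y_{k,t} − h·( ∇F(x_k) + (1/b)∑_{i∈A_{k,t}}(∇f_i(y_{k,t}) − ∇f_i(x_k)) ) ); and x_{k+1} = y_{k,T_k}. Then for every k ≥ 0, E[P(x_k) − P(x*)] ≤ ρ^k·( P(x_0) − P(x*) ). -/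

import Mathlib

section SmoothConvex

variable {E : Type*} [NormedAddCommGroup E] [InnerProductSpace ℝ E]

/-- If `t * a + t ^ 2 * c` is nonnegative for all small `t > 0`, then so is `a`. -/
lemma nonneg_of_forall_mul_add_sq_mul_nonneg {a c : ℝ}
    (H : ∀ t : ℝ, 0 < t → t ≤ 1 → 0 ≤ t * a + t ^ 2 * c) : 0 ≤ a := by
  by_contra! ha
  have hc : 0 < 2 * (|c| + 1) := by positivity
  set t := min 1 (-a / (2 * (|c| + 1)))
  have ht0 : 0 < t := lt_min one_pos (div_pos (by linarith) hc)
  have htc : t * (2 * (|c| + 1)) ≤ -a := (le_div_iff₀ hc).1 (min_le_right _ _)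
  have h1 := H t ht0 (min_le_left _ _)
  nlinarith [le_abs_self c, mul_le_mul_of_nonneg_left (le_abs_self c) ht0.le]

/-- `g` satisfies the first-order convexity inequality and the quadratic upper bound for `f`
with constant `L`: the two first-order consequences of `f` being convex with `L`-Lipschitz
gradient `g`. -/
def IsSmoothConvex (f : E → ℝ) (g : E → E) (L : ℝ) : Prop :=
  ∀ x y, f x + inner ℝ (g x) (y - x) ≤ f y ∧
    f y ≤ f x + inner ℝ (g x) (y - x) + L / 2 * ‖y - x‖ ^ 2

lemma HasGradientAt.hasDerivAt_line [CompleteSpace E] {f : E → ℝ} {g x u : E} {t : ℝ}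
    (hf : HasGradientAt f g (x + t • u)) :
    HasDerivAt (fun s : ℝ => f (x + s • u)) (inner ℝ g u) t := by
  have h1 : HasDerivAt (fun s : ℝ => x + s • u) u t := by
    simpa using ((hasDerivAt_id t).smul_const u).const_add x
  have h2 := hf.hasFDerivAt.comp_hasDerivAt t h1
  rw [InnerProductSpace.toDual_apply_apply] at h2
  exact h2

lemma ConvexOn.add_inner_le_of_hasGradientAt [CompleteSpace E] {f : E → ℝ} {x g : E}
    (hf : ConvexOn ℝ Set.univ f) (hg : HasGradientAt f g x) (y : E) :
    f x + inner ℝ g (y - x) ≤ f y := by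
  have hline : ConvexOn ℝ Set.univ (fun s : ℝ => f (x + s • (y - x))) := by
    have := hf.comp_affineMap (AffineMap.lineMap x y : ℝ →ᵃ[ℝ] E)
    refine this.congr fun s _ => ?_
    simp [AffineMap.lineMap_apply, add_comm]
  have hd : HasDerivAt (fun s : ℝ => f (x + s • (y - x))) (inner ℝ g (y - x)) 0 :=
    HasGradientAt.hasDerivAt_line (by simpa using hg)
  have := hline.le_slope_of_hasDerivAt (Set.mem_univ 0) (Set.mem_univ 1) one_pos hd
  simp [slope_def_field] at this
  linarith

lemma le_add_inner_add_of_lipschitz_gradient [CompleteSpace E] {f : E → ℝ} {g : E → E} {L : ℝ}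
    (hg : ∀ x, HasGradientAt f (g x) x) (hlip : ∀ x y, ‖g x - g y‖ ≤ L * ‖x - y‖) (x y : E) :
    f y ≤ f x + inner ℝ (g x) (y - x) + L / 2 * ‖y - x‖ ^ 2 := by
  set u := y - x with hu
  let φ : ℝ → ℝ := fun s =>
    f (x + s • u) - s * inner ℝ (g x) u - L / 2 * ‖u‖ ^ 2 * s ^ 2
  have hφ (s : ℝ) : HasDerivAt φ
      (inner ℝ (g (x + s • u)) u - inner ℝ (g x) u - L / 2 * ‖u‖ ^ 2 * (2 * s)) s := by
    refine ((hg _).hasDerivAt_line.sub ?_).sub ?_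
    · simpa using (hasDerivAt_id s).mul_const (inner ℝ (g x) u)
    · simpa using (hasDerivAt_pow 2 s).const_mul (L / 2 * ‖u‖ ^ 2)
  have hanti : AntitoneOn φ (Set.Icc 0 1) := by
    refine antitoneOn_of_deriv_nonpos (convex_Icc 0 1)
      (fun s _ => (hφ s).continuousAt.continuousWithinAt)
      (fun s _ => (hφ s).differentiableAt.differentiableWithinAt) fun s hs => ?_
    rw [interior_Icc] at hs
    rw [(hφ s).deriv, ← inner_sub_left]
    have h1 := real_inner_le_norm (g (x + s • u) - g x) u
    have h2 := hlip (x + s • u) x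
    rw [add_sub_cancel_left, norm_smul, Real.norm_of_nonneg hs.1.le] at h2
    nlinarith [mul_le_mul_of_nonneg_right h2 (norm_nonneg u)]
  have := hanti (Set.left_mem_Icc.2 zero_le_one) (Set.right_mem_Icc.2 zero_le_one) zero_le_one
  simp [φ, hu] at this
  linarith

lemma isSmoothConvex_of_hasGradientAt [CompleteSpace E] {f : E → ℝ} {g : E → E} {L : ℝ}
    (hf : ConvexOn ℝ Set.univ f) (hg : ∀ x, HasGradientAt f (g x) x)
    (hlip : ∀ x y, ‖g x - g y‖ ≤ L * ‖x - y‖) : IsSmoothConvex f g L := fun x y =>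
  ⟨hf.add_inner_le_of_hasGradientAt (hg x) y, le_add_inner_add_of_lipschitz_gradient hg hlip x y⟩

lemma IsSmoothConvex.average {n : ℕ} (hn : 0 < n) {f : Fin n → E → ℝ} {g : Fin n → E → E} {L : ℝ}
    (hf : ∀ i, IsSmoothConvex (f i) (g i) L) :
    IsSmoothConvex (fun x => (n : ℝ)⁻¹ * ∑ i, f i x) (fun x => (n : ℝ)⁻¹ • ∑ i, g i x) L := by
  intro x y
  have hn' : (0 : ℝ) < n := by exact_mod_cast hn
  have h1 := Finset.sum_le_sum fun i (_ : i ∈ Finset.univ) => (hf i x y).1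
  have h2 := Finset.sum_le_sum fun i (_ : i ∈ Finset.univ) => (hf i x y).2
  simp only [Finset.sum_add_distrib, Finset.sum_const, Finset.card_univ, Fintype.card_fin,
    nsmul_eq_mul] at h1 h2
  simp only [real_inner_smul_left, sum_inner]
  have h3 := mul_le_mul_of_nonneg_left h1 (inv_pos.2 hn').le
  have h4 := mul_le_mul_of_nonneg_left h2 (inv_pos.2 hn').le
  have h5 : (n : ℝ)⁻¹ * (n * (L / 2 * ‖y - x‖ ^ 2)) = L / 2 * ‖y - x‖ ^ 2 := by field_simp
  constructor <;> linarith

lemma IsSmoothConvex.norm_sub_sq_le {f : E → ℝ} {g : E → E} {L : ℝ} (hL : 0 < L)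
    (hf : IsSmoothConvex f g L) (x y : E) :
    ‖g x - g y‖ ^ 2 ≤ 2 * L * (f x - f y - inner ℝ (g y) (x - y)) := by
  set w := x - L⁻¹ • (g x - g y) with hw
  have h1 := (hf y w).1
  have h2 := (hf x w).2
  have e1 : w - y = (x - y) - L⁻¹ • (g x - g y) := by rw [hw]; abel
  have e2 : w - x = -(L⁻¹ • (g x - g y)) := by rw [hw]; abel
  rw [e1, inner_sub_right, real_inner_smul_right] at h1
  rw [e2, inner_neg_right, real_inner_smul_right, norm_neg, norm_smul, mul_pow,
    Real.norm_of_nonneg (inv_pos.2 hL).le] at h2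
  have h3 : inner ℝ (g x) (g x - g y) - inner ℝ (g y) (g x - g y) = ‖g x - g y‖ ^ 2 := by
    rw [← inner_sub_left, real_inner_self_eq_norm_sq]
  have h4 : L / 2 * (L⁻¹ ^ 2 * ‖g x - g y‖ ^ 2) = L⁻¹ * ‖g x - g y‖ ^ 2 / 2 := by
    field_simp
  have h5 : L⁻¹ * ‖g x - g y‖ ^ 2 / 2 ≤ f x - f y - inner ℝ (g y) (x - y) := by
    rw [h4] at h2
    rw [← h3] at h2 ⊢
    linarith
  have h6 : ‖g x - g y‖ ^ 2 = 2 * L * (L⁻¹ * ‖g x - g y‖ ^ 2 / 2) := by field_simp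
  rw [h6]
  gcongr

end SmoothConvex

section Composite

variable {E : Type*} [NormedAddCommGroup E] [InnerProductSpace ℝ E]

lemma ConvexOn.apply_add_smul_sub_le {φ : E → ℝ} (hφ : ConvexOn ℝ Set.univ φ) (x y : E) {t : ℝ}
    (h0 : 0 ≤ t) (h1 : t ≤ 1) : φ (x + t • (y - x)) ≤ φ x + t * (φ y - φ x) := by
  have := hφ.2 (Set.mem_univ x) (Set.mem_univ y) (sub_nonneg.2 h1) h0 (by ring)
  have e : x + t • (y - x) = (1 - t) • x + t • y := by module
  rw [e]
  simp only [smul_eq_mul] at this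
  linarith

lemma norm_add_smul_sq (x u : E) (t : ℝ) :
    ‖x + t • u‖ ^ 2 = ‖x‖ ^ 2 + 2 * t * inner ℝ x u + t ^ 2 * ‖u‖ ^ 2 := by
  rw [norm_add_sq_real, real_inner_smul_right, norm_smul, mul_pow, Real.norm_eq_abs, sq_abs]
  ring

/-- `prox` is a proximal map of `h • R`. -/
def IsProx (R : E → ℝ) (h : ℝ) (prox : E → E) : Prop :=
  ∀ z w, (1 / 2) * ‖prox z - z‖ ^ 2 + h * R (prox z) ≤ (1 / 2) * ‖w - z‖ ^ 2 + h * R w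

lemma IsProx.add_inner_le {R : E → ℝ} {h : ℝ} {prox : E → E} (hp : IsProx R h prox)
    (hR : ConvexOn ℝ Set.univ R) (hh : 0 < h) (z w : E) :
    h * R (prox z) + inner ℝ (z - prox z) (w - prox z) ≤ h * R w := by
  rw [← sub_nonneg]
  refine nonneg_of_forall_mul_add_sq_mul_nonneg (c := ‖w - prox z‖ ^ 2 / 2) fun t h0 h1 => ?_
  have h2 := hp z (prox z + t • (w - prox z))
  have h3 := mul_le_mul_of_nonneg_left (hR.apply_add_smul_sub_le (prox z) w h0.le h1) hh.le
  have e : prox z + t • (w - prox z) - z = (prox z - z) + t • (w - prox z) := by abel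
  rw [e, norm_add_smul_sq] at h2
  have e2 : inner ℝ (z - prox z) (w - prox z) = -inner ℝ (prox z - z) (w - prox z) := by
    rw [← inner_neg_left, neg_sub]
  rw [e2]
  linarith

lemma IsProx.norm_sub_le {R : E → ℝ} {h : ℝ} {prox : E → E} (hp : IsProx R h prox)
    (hR : ConvexOn ℝ Set.univ R) (hh : 0 < h) (z w : E) : ‖prox z - prox w‖ ≤ ‖z - w‖ := by
  have h1 := hp.add_inner_le hR hh z (prox w)
  have h2 := hp.add_inner_le hR hh w (prox z)
  have e : inner ℝ (z - prox z) (prox w - prox z) + inner ℝ (w - prox w) (prox z - prox w)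
      = ‖prox z - prox w‖ ^ 2 - inner ℝ (z - w) (prox z - prox w) := by
    rw [← neg_sub (prox z) (prox w), inner_neg_right, ← real_inner_self_eq_norm_sq]
    simp only [inner_sub_left, inner_sub_right]
    ring
  have h3 := real_inner_le_norm (z - w) (prox z - prox w)
  have h4 : ‖prox z - prox w‖ * ‖prox z - prox w‖ ≤ ‖z - w‖ * ‖prox z - prox w‖ := by
    nlinarith
  by_contra! hlt
  exact absurd h4 (not_le.2 (mul_lt_mul_of_pos_right hlt ((norm_nonneg _).trans_lt hlt)))

variable {F R : E → ℝ} {G : E → E} {L μ : ℝ} {xs : E}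

lemma neg_inner_le_of_isMin (hF : IsSmoothConvex F G L) (hR : ConvexOn ℝ Set.univ R)
    (hxs : ∀ x, F xs + R xs ≤ F x + R x) (x : E) :
    R xs - inner ℝ (G xs) (x - xs) ≤ R x := by
  have : 0 ≤ R x - R xs + inner ℝ (G xs) (x - xs) := by
    refine nonneg_of_forall_mul_add_sq_mul_nonneg (c := L / 2 * ‖x - xs‖ ^ 2) fun t h0 h1 => ?_
    have h2 := hxs (xs + t • (x - xs))
    have h3 := (hF xs (xs + t • (x - xs))).2
    have h4 := hR.apply_add_smul_sub_le xs x h0.le h1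
    rw [add_sub_cancel_left, real_inner_smul_right, norm_smul, mul_pow, Real.norm_eq_abs,
      sq_abs] at h3
    linarith
  linarith

lemma norm_sub_sq_le_of_isMin {P : E → ℝ}
    (hP : ConvexOn ℝ Set.univ (fun x => P x - μ / 2 * ‖x‖ ^ 2)) (hxs : ∀ x, P xs ≤ P x) (x : E) :
    μ / 2 * ‖x - xs‖ ^ 2 ≤ P x - P xs := by
  rw [← sub_nonneg]
  refine nonneg_of_forall_mul_add_sq_mul_nonneg (c := μ / 2 * ‖x - xs‖ ^ 2) fun t h0 h1 => ?_
  have h2 := hxs (xs + t • (x - xs))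
  have h4 := hP.apply_add_smul_sub_le xs x h0.le h1
  simp only [norm_add_smul_sq] at h4
  have h5 : ‖x‖ ^ 2 = ‖xs‖ ^ 2 + 2 * 1 * inner ℝ xs (x - xs) + 1 ^ 2 * ‖x - xs‖ ^ 2 := by
    rw [← norm_add_smul_sq]; simp
  rw [h5] at h4
  linarith

/-- One inexact proximal gradient step, with gradient estimate `v`. -/
lemma prox_step_le {h : ℝ} {prox : E → E} (hF : IsSmoothConvex F G L)
    (hR : ConvexOn ℝ Set.univ R) (hp : IsProx R h prox) (hh : 0 < h) (hhL : h * L ≤ 1)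
    (y v x : E) :
    ‖prox (y - h • v) - x‖ ^ 2 + 2 * h * (F (prox (y - h • v)) + R (prox (y - h • v)) - (F x + R x))
      ≤ ‖y - x‖ ^ 2 + 2 * h ^ 2 * ‖v - G y‖ ^ 2
        - 2 * h * inner ℝ (v - G y) (prox (y - h • G y) - x) := by
  set p := prox (y - h • v) with hpdef
  set q := prox (y - h • G y) with hqdef
  have h1 := mul_le_mul_of_nonneg_left (hF y p).2 hh.le
  have h2 := mul_le_mul_of_nonneg_left (hF y x).1 hh.le
  have h3 := hp.add_inner_le hR hh (y - h • v) x
  rw [← hpdef] at h3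
  have h4 : -(inner ℝ (v - G y) (p - q)) ≤ h * ‖v - G y‖ ^ 2 := by
    have a1 := hp.norm_sub_le hR hh (y - h • v) (y - h • G y)
    have e : y - h • v - (y - h • G y) = -(h • (v - G y)) := by module
    rw [e, norm_neg, norm_smul, Real.norm_of_nonneg hh.le, ← hpdef, ← hqdef] at a1
    have a2 := abs_real_inner_le_norm (v - G y) (p - q)
    have a3 := neg_abs_le (inner ℝ (v - G y) (p - q))
    nlinarith [norm_nonneg (v - G y)]
  have h5 : h * (L / 2 * ‖p - y‖ ^ 2) ≤ ‖p - y‖ ^ 2 / 2 := by nlinarith [sq_nonneg ‖p - y‖]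
  have h6 : ‖y - x‖ ^ 2 = ‖p - x‖ ^ 2 - 2 * inner ℝ (p - y) (p - x) + ‖p - y‖ ^ 2 := by
    have e : y - x = (p - x) - (p - y) := by abel
    rw [e, norm_sub_sq_real, real_inner_comm]
  have h7 : inner ℝ (y - h • v - p) (x - p)
      = inner ℝ (p - y) (p - x) + h * inner ℝ v (p - x) := by
    have e : y - h • v - p = -((p - y) + h • v) := by module
    rw [e, ← neg_sub p x, inner_neg_neg, inner_add_left, real_inner_smul_left]
  have h8 : inner ℝ (G y) (p - y) - inner ℝ (G y) (x - y) = inner ℝ (G y) (p - x) := by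
    rw [← inner_sub_right]; congr 1; abel
  have h9 : inner ℝ v (p - x) - inner ℝ (G y) (p - x)
      = inner ℝ (v - G y) (p - q) + inner ℝ (v - G y) (q - x) := by
    rw [← inner_sub_left, ← inner_add_right]; congr 1; abel
  have h10 := mul_le_mul_of_nonneg_left h4 hh.le
  rw [h7] at h3
  have h8' := congrArg (h * ·) h8
  have h9' := congrArg (h * ·) h9
  linarith

end Composite

section Sampling

open Finset

lemma card_filter_mem_powersetCard_mul {n b : ℕ} (hb : 1 ≤ b) (hbn : b ≤ n) (i : Fin n) :
    (#{B ∈ powersetCard b (univ : Finset (Fin n)) | i ∈ B} : ℝ) * n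
      = #(powersetCard b (univ : Finset (Fin n))) * b := by
  have h1 := card_filter_powersetCard_subset {i} (univ : Finset (Fin n)) b (subset_univ _)
    (by simpa using hb)
  simp only [singleton_subset_iff, card_univ, Fintype.card_fin, card_singleton] at h1
  rw [h1, card_powersetCard, card_univ, Fintype.card_fin]
  obtain ⟨b, rfl⟩ := Nat.exists_eq_add_of_le' hb
  obtain ⟨n, rfl⟩ := Nat.exists_eq_add_of_le' (hb.trans hbn)
  have := Nat.add_one_mul_choose_eq n b
  simp only [Nat.add_sub_cancel]
  rw [mul_comm]
  exact_mod_cast this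

lemma card_filter_mem_mem_powersetCard_mul {n b : ℕ} (hb : 1 ≤ b) (hbn : b ≤ n) {i j : Fin n}
    (hij : i ≠ j) :
    (#{B ∈ powersetCard b (univ : Finset (Fin n)) | i ∈ B ∧ j ∈ B} : ℝ) * (n * (n - 1))
      = #(powersetCard b (univ : Finset (Fin n))) * (b * (b - 1)) := by
  have hsub (B : Finset (Fin n)) : i ∈ B ∧ j ∈ B ↔ {i, j} ⊆ B := by
    simp [insert_subset_iff]
  simp only [hsub]
  have hc : #{i, j} = 2 := card_pair hij
  rcases hb.eq_or_lt with rfl | hb2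
  · have : #{B ∈ powersetCard 1 (univ : Finset (Fin n)) | {i, j} ⊆ B} = 0 := by
      rw [card_eq_zero, filter_eq_empty_iff]
      intro B hB hsubset
      have := card_le_card hsubset
      rw [mem_powersetCard] at hB
      omega
    rw [this]
    simp
  · have h1 := card_filter_powersetCard_subset {i, j} (univ : Finset (Fin n)) b (subset_univ _)
      (by omega)
    rw [h1, card_powersetCard, card_univ, Fintype.card_fin, hc]
    obtain ⟨b, rfl⟩ := Nat.exists_eq_add_of_le' (show 2 ≤ b from hb2)
    obtain ⟨n, rfl⟩ := Nat.exists_eq_add_of_le' ((show 2 ≤ b + 2 by omega).trans hbn)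
    have e1 : ((n : ℝ) + 1) * n.choose b = (n + 1).choose (b + 1) * (b + 1) := by
      exact_mod_cast Nat.add_one_mul_choose_eq n b
    have e2 : ((n : ℝ) + 2) * (n + 1).choose (b + 1) = (n + 2).choose (b + 2) * (b + 2) := by
      exact_mod_cast Nat.add_one_mul_choose_eq (n + 1) (b + 1)
    simp only [Nat.add_sub_cancel]
    push_cast
    linear_combination ((n : ℝ) + 2) * e1 + ((b : ℝ) + 1) * e2

variable {E : Type*} [NormedAddCommGroup E] [InnerProductSpace ℝ E]

lemma sum_powersetCard_sum {n b : ℕ} (hb : 1 ≤ b) (hbn : b ≤ n) (ξ : Fin n → E) :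
    ∑ B ∈ powersetCard b (univ : Finset (Fin n)), ∑ i ∈ B, ξ i
      = ((#(powersetCard b (univ : Finset (Fin n))) : ℝ) * b / n) • ∑ i, ξ i := by
  have hn : (n : ℝ) ≠ 0 := by exact_mod_cast (show n ≠ 0 by omega)
  have h1 (B : Finset (Fin n)) : ∑ i ∈ B, ξ i = ∑ i, if i ∈ B then ξ i else 0 := by
    rw [← sum_filter, filter_mem_eq_inter, univ_inter]
  rw [sum_congr rfl fun B _ => h1 B, sum_comm, smul_sum]
  refine sum_congr rfl fun i _ => ?_
  rw [← sum_filter, sum_const, ← Nat.cast_smul_eq_nsmul ℝ,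
    ← card_filter_mem_powersetCard_mul hb hbn i, mul_div_cancel_right₀ _ hn]

lemma sum_powersetCard_average_sub {n b : ℕ} (hb : 1 ≤ b) (hbn : b ≤ n) (ξ : Fin n → E) :
    ∑ B ∈ powersetCard b (univ : Finset (Fin n)),
      ((b : ℝ)⁻¹ • ∑ i ∈ B, ξ i - (n : ℝ)⁻¹ • ∑ i, ξ i) = 0 := by
  have hb0 : (b : ℝ) ≠ 0 := by exact_mod_cast (show b ≠ 0 by omega)
  rw [sum_sub_distrib, ← smul_sum, sum_powersetCard_sum hb hbn, sum_const,
    ← Nat.cast_smul_eq_nsmul ℝ, smul_smul, smul_smul, sub_eq_zero]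
  congr 1
  field_simp

/-- The variance of the mean of a sample of size `b` without replacement, for centred data. -/
lemma sum_powersetCard_norm_sum_sq {n b : ℕ} (hn : 2 ≤ n) (hb : 1 ≤ b) (hbn : b ≤ n)
    (ζ : Fin n → E) (hζ : ∑ i, ζ i = 0) :
    ∑ B ∈ powersetCard b (univ : Finset (Fin n)), ‖∑ i ∈ B, ζ i‖ ^ 2
      = #(powersetCard b (univ : Finset (Fin n))) * (b * (n - b) / (n * (n - 1)))
        * ∑ i, ‖ζ i‖ ^ 2 := by
  set S := powersetCard b (univ : Finset (Fin n))
  have hn0 : (n : ℝ) ≠ 0 := by exact_mod_cast (show n ≠ 0 by omega)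
  have hn1 : (n : ℝ) - 1 ≠ 0 := by
    have : (2 : ℝ) ≤ n := by exact_mod_cast hn
    linarith
  set c : ℝ := #S * (b * (b - 1)) / (n * (n - 1)) with hc
  have hcount (i j : Fin n) : (#{B ∈ S | i ∈ B ∧ j ∈ B} : ℝ)
      = c + if i = j then (#S * (b * (n - b) / (n * (n - 1))) : ℝ) else 0 := by
    split_ifs with hij
    · subst hij
      simp only [and_self]
      have h1 : (#{B ∈ S | i ∈ B} : ℝ) * n = #S * b := card_filter_mem_powersetCard_mul hb hbn i
      rw [eq_div_of_mul_eq hn0 h1, hc]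
      field_simp
      ring
    · rw [add_zero]
      exact eq_div_of_mul_eq (mul_ne_zero hn0 hn1)
        (card_filter_mem_mem_powersetCard_mul hb hbn hij)
  have hexp (B : Finset (Fin n)) : ‖∑ i ∈ B, ζ i‖ ^ 2
      = ∑ i, ∑ j, if i ∈ B ∧ j ∈ B then inner ℝ (ζ i) (ζ j) else 0 := by
    rw [← real_inner_self_eq_norm_sq, sum_inner]
    simp only [inner_sum, ← sum_product']
    rw [← sum_filter]
    refine sum_congr ?_ fun _ _ => rfl
    ext
    simp
  calc ∑ B ∈ S, ‖∑ i ∈ B, ζ i‖ ^ 2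
      = ∑ i, ∑ j, (#{B ∈ S | i ∈ B ∧ j ∈ B} : ℝ) * inner ℝ (ζ i) (ζ j) := by
        simp only [hexp]
        rw [sum_comm]
        refine sum_congr rfl fun i _ => ?_
        rw [sum_comm]
        refine sum_congr rfl fun j _ => ?_
        rw [← sum_filter, sum_const, nsmul_eq_mul]
    _ = _ := by
        simp only [hcount, add_mul, sum_add_distrib, ite_mul, zero_mul, sum_ite_eq, mem_univ,
          if_true, real_inner_self_eq_norm_sq, ← mul_sum, ← inner_sum, hζ, inner_zero_right,
          mul_zero, zero_add]

lemma sum_norm_sub_average_sq_le {n : ℕ} (hn : 0 < n) (ξ : Fin n → E) :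
    ∑ i, ‖ξ i - (n : ℝ)⁻¹ • ∑ j, ξ j‖ ^ 2 ≤ ∑ i, ‖ξ i‖ ^ 2 := by
  have hn0 : (n : ℝ) ≠ 0 := by exact_mod_cast hn.ne'
  simp only [norm_sub_sq_real, sum_add_distrib, sum_sub_distrib, ← mul_sum, ← sum_inner,
    real_inner_smul_right, real_inner_self_eq_norm_sq, sum_const, card_univ, Fintype.card_fin,
    nsmul_eq_mul, norm_smul, mul_pow, Real.norm_eq_abs, sq_abs]
  have : (n : ℝ)⁻¹ ^ 2 * ((n : ℝ) * ‖∑ j, ξ j‖ ^ 2) = (n : ℝ)⁻¹ * ‖∑ j, ξ j‖ ^ 2 := by field_simp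
  rw [this]
  have : 0 ≤ (n : ℝ)⁻¹ * ‖∑ j, ξ j‖ ^ 2 := by positivity
  linarith

lemma sum_powersetCard_norm_average_sub_sq_le {n b : ℕ} (hn : 2 ≤ n) (hb : 1 ≤ b) (hbn : b ≤ n)
    (ξ : Fin n → E) :
    ∑ B ∈ powersetCard b (univ : Finset (Fin n)),
        ‖(b : ℝ)⁻¹ • ∑ i ∈ B, ξ i - (n : ℝ)⁻¹ • ∑ i, ξ i‖ ^ 2
      ≤ #(powersetCard b (univ : Finset (Fin n))) *
        (((n : ℝ) - b) / (b * (n - 1)) * ((n : ℝ)⁻¹ * ∑ i, ‖ξ i‖ ^ 2)) := by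
  have hb0 : (0 : ℝ) < b := by exact_mod_cast (show 0 < b by omega)
  have hn2 : (2 : ℝ) ≤ n := by exact_mod_cast hn
  have hbn' : (b : ℝ) ≤ n := by exact_mod_cast hbn
  have hn1 : (0 : ℝ) < (n : ℝ) - 1 := by linarith
  set c := (n : ℝ)⁻¹ • ∑ i, ξ i with hc
  have hcent : ∑ i, (ξ i - c) = 0 := by
    rw [sum_sub_distrib, sum_const, card_univ, Fintype.card_fin, ← Nat.cast_smul_eq_nsmul ℝ, hc,
      smul_inv_smul₀ (by linarith), sub_self]
  have hterm : ∀ B ∈ powersetCard b (univ : Finset (Fin n)),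
      ‖(b : ℝ)⁻¹ • ∑ i ∈ B, ξ i - c‖ ^ 2 = (b : ℝ)⁻¹ ^ 2 * ‖∑ i ∈ B, (ξ i - c)‖ ^ 2 := by
    intro B hB
    have hBc : #B = b := (mem_powersetCard.1 hB).2
    rw [← sq_abs (b : ℝ)⁻¹, ← Real.norm_eq_abs, ← mul_pow, ← norm_smul, sum_sub_distrib, sum_const,
      hBc, smul_sub, ← Nat.cast_smul_eq_nsmul ℝ, inv_smul_smul₀ hb0.ne']
  rw [sum_congr rfl hterm, ← mul_sum, sum_powersetCard_norm_sum_sq hn hb hbn _ hcent]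
  have hle := sum_norm_sub_average_sq_le (show 0 < n by omega) ξ
  rw [← hc] at hle
  calc _ = #(powersetCard b (univ : Finset (Fin n))) *
        (((n : ℝ) - b) / (b * (n - 1)) * ((n : ℝ)⁻¹ * ∑ i, ‖ξ i - c‖ ^ 2)) := by
        field_simp
    _ ≤ _ := by
        have : 0 ≤ ((n : ℝ) - b) / (b * (n - 1)) :=
          div_nonneg (by linarith) (by positivity)
        gcongr

end Sampling

section Epochs

open Finset

lemma sum_piFinset_snoc {Ω M : Type*} [AddCommMonoid M] {k : ℕ} (S : Finset Ω)
    (g : (Fin (k + 1) → Ω) → M) :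
    ∑ ω ∈ Fintype.piFinset (fun _ : Fin (k + 1) => S), g ω
      = ∑ ω ∈ Fintype.piFinset (fun _ : Fin k => S), ∑ a ∈ S,
          g (Fin.snoc (α := fun _ => Ω) ω a) := by
  rw [← sum_product']
  symm
  refine sum_nbij' (fun p => Fin.snoc (α := fun _ => Ω) p.1 p.2)
    (fun ω => (fun i => ω i.castSucc, ω (Fin.last k))) ?_ ?_ ?_ ?_ fun _ _ => rfl
  · rintro ⟨ω, a⟩ hp
    simp only [mem_product, Fintype.mem_piFinset] at hp ⊢
    refine Fin.lastCases ?_ fun i => ?_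
    · simpa using hp.2
    · simpa using hp.1 i
  · intro ω hω
    simp only [mem_product, Fintype.mem_piFinset] at hω ⊢
    exact ⟨fun i => hω _, hω _⟩
  · rintro ⟨ω, a⟩ -
    simp
  · intro ω _
    exact Fin.snoc_init_self ω

/-- If `y` does not depend on the coordinate `t`, then that coordinate can be resampled. -/
lemma sum_piFinset_sum_eq_of_update {ι β γ : Type*} [Fintype ι] [DecidableEq ι] (S : Finset β)
    (t : ι) (y : (ι → β) → γ) (hy : ∀ A B, y (Function.update A t B) = y A) (φ : γ → β → ℝ) :
    ∑ A ∈ Fintype.piFinset (fun _ : ι => S), ∑ B ∈ S, φ (y A) B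
      = #S * ∑ A ∈ Fintype.piFinset (fun _ : ι => S), φ (y A) (A t) := by
  have h1 : #S * ∑ A ∈ Fintype.piFinset (fun _ : ι => S), φ (y A) (A t)
      = ∑ A ∈ Fintype.piFinset (fun _ : ι => S), ∑ _B ∈ S, φ (y A) (A t) := by
    simp only [sum_const, nsmul_eq_mul, mul_sum]
  rw [h1, ← sum_product', ← sum_product']
  have hmem : ∀ p ∈ Fintype.piFinset (fun _ : ι => S) ×ˢ S,
      (Function.update p.1 t p.2, p.1 t) ∈ Fintype.piFinset (fun _ : ι => S) ×ˢ S := by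
    rintro ⟨A, B⟩ hp
    simp only [mem_product, Fintype.mem_piFinset] at hp ⊢
    refine ⟨fun i => ?_, hp.1 t⟩
    by_cases hi : i = t
    · subst hi; simpa using hp.2
    · simpa [hi] using hp.1 i
  refine sum_nbij' (fun p => (Function.update p.1 t p.2, p.1 t))
    (fun p => (Function.update p.1 t p.2, p.1 t)) hmem hmem ?_ ?_ ?_ <;>
  · rintro ⟨A, B⟩ -
    simp [hy]

/-- The total expected decrease over one epoch of a stochastic iteration whose steps satisfy a
one-step inequality with potential `D` and suboptimality `e`. -/
lemma sum_epoch_le {E β : Type*} {m : ℕ} (S : Finset β) (hS : S.Nonempty) {h c : ℝ} (hc : 0 ≤ c)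
    (D e : E → ℝ) (hD : ∀ x, 0 ≤ D x) (he : ∀ x, 0 ≤ e x) (x : E) (step : E → β → E)
    (hstep : ∀ z, ∑ B ∈ S, (D (step z B) + 2 * h * e (step z B)) ≤ #S * (D z + c * (e z + e x)))
    (y : (Fin m → β) → ℕ → E) (hy0 : ∀ A, y A 0 = x)
    (hys : ∀ A (t : Fin m), y A (t + 1) = step (y A t) (A t)) :
    (2 * h - c) * ∑ A ∈ Fintype.piFinset (fun _ : Fin m => S), ∑ j : Fin m, e (y A (j + 1))
      ≤ #(Fintype.piFinset (fun _ : Fin m => S)) * (D x + c * (m + 1) * e x) := by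
  set Q := Fintype.piFinset (fun _ : Fin m => S)
  have hSpos : (0 : ℝ) < #S := by exact_mod_cast hS.card_pos
  have hindep (t : Fin m) (B : β) (A : Fin m → β) (s : ℕ) (hs : s ≤ t) :
      y (Function.update A t B) s = y A s := by
    induction s with
    | zero => rw [hy0, hy0]
    | succ s ih =>
      have hne : (⟨s, by omega⟩ : Fin m) ≠ t := fun heq => by
        have := congrArg Fin.val heq
        simp only at this
        omega
      have h1 := hys (Function.update A t B) ⟨s, by omega⟩
      have h2 := hys A ⟨s, by omega⟩
      simp only [Function.update_of_ne hne] at h1 h2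
      rw [h1, h2, ih (by omega)]
  have hone (t : ℕ) (ht : t < m) :
      ∑ A ∈ Q, D (y A (t + 1)) + 2 * h * ∑ A ∈ Q, e (y A (t + 1))
        ≤ ∑ A ∈ Q, D (y A t) + c * (∑ A ∈ Q, e (y A t) + #Q * e x) := by
    have h1 := sum_piFinset_sum_eq_of_update S ⟨t, ht⟩ (fun A => y A t)
      (fun A B => hindep _ B A t le_rfl) (fun z B => D (step z B) + 2 * h * e (step z B))
    have h2 := sum_le_sum fun A (_ : A ∈ Q) => hstep (y A t)
    rw [h1, ← mul_sum] at h2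
    have h3 := le_of_mul_le_mul_left h2 hSpos
    simp only [← hys _ ⟨t, ht⟩, sum_add_distrib, ← mul_sum, sum_const, nsmul_eq_mul] at h3
    exact h3
  have htel (s : ℕ) (hs : s ≤ m) :
      ∑ A ∈ Q, D (y A s) + 2 * h * ∑ t ∈ range s, ∑ A ∈ Q, e (y A (t + 1))
        ≤ #Q * D x + c * (∑ t ∈ range s, ∑ A ∈ Q, e (y A t) + s * (#Q * e x)) := by
    induction s with
    | zero => simp [hy0]
    | succ s ih =>
      have h1 := ih (by omega)
      have h2 := hone s (by omega)
      rw [sum_range_succ, sum_range_succ]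
      push_cast
      linarith
  have hshift : ∑ t ∈ range m, ∑ A ∈ Q, e (y A t)
      ≤ ∑ t ∈ range m, ∑ A ∈ Q, e (y A (t + 1)) + #Q * e x := by
    have h1 := sum_range_succ (fun t => ∑ A ∈ Q, e (y A t)) m
    rw [sum_range_succ'] at h1
    simp only [hy0, sum_const, nsmul_eq_mul] at h1
    have h2 : 0 ≤ ∑ A ∈ Q, e (y A m) := sum_nonneg fun A _ => he _
    linarith
  have hsum : ∑ A ∈ Q, ∑ j : Fin m, e (y A (j + 1))
      = ∑ t ∈ range m, ∑ A ∈ Q, e (y A (t + 1)) := by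
    rw [sum_comm, ← Fin.sum_univ_eq_sum_range (fun t => ∑ A ∈ Q, e (y A (t + 1)))]
  have hfin := htel m le_rfl
  have hDm : 0 ≤ ∑ A ∈ Q, D (y A m) := sum_nonneg fun A _ => hD _
  have hcs := mul_le_mul_of_nonneg_left hshift hc
  rw [hsum]
  linarith

end Epochs

section VarianceReduction

open Finset

variable {E : Type*} [NormedAddCommGroup E] [InnerProductSpace ℝ E]

lemma average_norm_sub_sq_le {n : ℕ} (hn : 0 < n) {f : Fin n → E → ℝ} {g : Fin n → E → E}
    {L : ℝ} (hL : 0 < L) (hf : ∀ i, IsSmoothConvex (f i) (g i) L) {R : E → ℝ}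
    (hR : ConvexOn ℝ Set.univ R) {P : E → ℝ} (hP : ∀ x, P x = (n : ℝ)⁻¹ * ∑ i, f i x + R x)
    {xs : E} (hxs : ∀ x, P xs ≤ P x) (x : E) :
    (n : ℝ)⁻¹ * ∑ i, ‖g i x - g i xs‖ ^ 2 ≤ 2 * L * (P x - P xs) := by
  have h1 := neg_inner_le_of_isMin (IsSmoothConvex.average hn hf) hR
    (fun x => by simpa only [hP] using hxs x) x
  have h2 := mul_le_mul_of_nonneg_left
    (sum_le_sum fun i (_ : i ∈ univ) => (hf i).norm_sub_sq_le hL x xs)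
    (inv_nonneg.2 (Nat.cast_nonneg (α := ℝ) n))
  refine h2.trans ?_
  simp only [real_inner_smul_left, sum_inner] at h1
  rw [← mul_sum, sum_sub_distrib, sum_sub_distrib, mul_left_comm, hP, hP]
  refine mul_le_mul_of_nonneg_left ?_ (by positivity)
  linarith

/-- One variance-reduced proximal step, averaged over all mini-batches. -/
lemma sum_powersetCard_prox_step_le {n b : ℕ} (hn : 2 ≤ n) (hb : 1 ≤ b) (hbn : b ≤ n)
    {f : Fin n → E → ℝ} {g : Fin n → E → E} {L : ℝ} (hL : 0 < L)
    (hf : ∀ i, IsSmoothConvex (f i) (g i) L) {R : E → ℝ} (hR : ConvexOn ℝ Set.univ R)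
    {P : E → ℝ} (hP : ∀ x, P x = (n : ℝ)⁻¹ * ∑ i, f i x + R x)
    {xs : E} (hxs : ∀ x, P xs ≤ P x) {h : ℝ} (hh : 0 < h) (hhL : h * L ≤ 1) {prox : E → E}
    (hp : IsProx R h prox) (x y : E) (p : Finset (Fin n) → E)
    (hpB : ∀ B, p B = prox (y - h • ((n : ℝ)⁻¹ • ∑ i, g i x
      + (b : ℝ)⁻¹ • ∑ i ∈ B, (g i y - g i x)))) :
    ∑ B ∈ powersetCard b univ, (‖p B - xs‖ ^ 2 + 2 * h * (P (p B) - P xs))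
      ≤ #(powersetCard b (univ : Finset (Fin n))) * (‖y - xs‖ ^ 2
        + 8 * h ^ 2 * L * (((n : ℝ) - b) / (b * (n - 1))) * ((P y - P xs) + (P x - P xs))) := by
  set S := powersetCard b (univ : Finset (Fin n))
  set α := ((n : ℝ) - b) / (b * (n - 1)) with hα
  have hα0 : 0 ≤ α := by
    have h1 : (2 : ℝ) ≤ n := by exact_mod_cast hn
    have h2 : (b : ℝ) ≤ n := by exact_mod_cast hbn
    exact div_nonneg (by linarith) (mul_nonneg (Nat.cast_nonneg b) (by linarith))
  let ξ : Fin n → E := fun i => g i y - g i x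
  let Δ : Finset (Fin n) → E := fun B => (b : ℝ)⁻¹ • ∑ i ∈ B, ξ i - (n : ℝ)⁻¹ • ∑ i, ξ i
  set q := prox (y - h • ((n : ℝ)⁻¹ • ∑ i, g i y))
  have hstep (B : Finset (Fin n)) : ‖p B - xs‖ ^ 2 + 2 * h * (P (p B) - P xs)
      ≤ ‖y - xs‖ ^ 2 + 2 * h ^ 2 * ‖Δ B‖ ^ 2 - 2 * h * inner ℝ (Δ B) (q - xs) := by
    have h1 := prox_step_le (IsSmoothConvex.average (by omega) hf) hR hp hh hhL y
      ((n : ℝ)⁻¹ • ∑ i, g i x + (b : ℝ)⁻¹ • ∑ i ∈ B, (g i y - g i x)) xs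
    have e : (n : ℝ)⁻¹ • ∑ i, g i x + (b : ℝ)⁻¹ • ∑ i ∈ B, (g i y - g i x)
        - (n : ℝ)⁻¹ • ∑ i, g i y = Δ B := by
      simp only [Δ, ξ, sum_sub_distrib, smul_sub]
      abel
    rw [e, ← hpB, ← hP, ← hP] at h1
    exact h1
  have hmean : ∑ B ∈ S, Δ B = 0 := sum_powersetCard_average_sub hb hbn ξ
  have hvar : ∑ B ∈ S, ‖Δ B‖ ^ 2 ≤ #S * (α * ((n : ℝ)⁻¹ * ∑ i, ‖ξ i‖ ^ 2)) :=
    sum_powersetCard_norm_average_sub_sq_le hn hb hbn ξ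
  have hξ : (n : ℝ)⁻¹ * ∑ i, ‖ξ i‖ ^ 2 ≤ 4 * L * ((P y - P xs) + (P x - P xs)) := by
    have hx := average_norm_sub_sq_le (by omega) hL hf hR hP hxs x
    have hy := average_norm_sub_sq_le (by omega) hL hf hR hP hxs y
    have hi (i : Fin n) : ‖ξ i‖ ^ 2 ≤ 2 * ‖g i y - g i xs‖ ^ 2 + 2 * ‖g i x - g i xs‖ ^ 2 := by
      have e : ξ i = (g i y - g i xs) - (g i x - g i xs) := by simp only [ξ]; abel
      have := parallelogram_law_with_norm ℝ (g i y - g i xs) (g i x - g i xs)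
      rw [e]
      nlinarith [sq_nonneg ‖(g i y - g i xs) + (g i x - g i xs)‖]
    have h1 := mul_le_mul_of_nonneg_left (sum_le_sum fun i (_ : i ∈ univ) => hi i)
      (inv_nonneg.2 (Nat.cast_nonneg (α := ℝ) n))
    rw [sum_add_distrib, ← mul_sum, ← mul_sum] at h1
    linarith
  calc _ ≤ ∑ B ∈ S, (‖y - xs‖ ^ 2 + 2 * h ^ 2 * ‖Δ B‖ ^ 2 - 2 * h * inner ℝ (Δ B) (q - xs)) :=
        sum_le_sum fun B _ => hstep B
    _ = #S * ‖y - xs‖ ^ 2 + 2 * h ^ 2 * ∑ B ∈ S, ‖Δ B‖ ^ 2 := by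
        rw [sum_sub_distrib, sum_add_distrib, ← mul_sum, ← mul_sum, ← sum_inner, hmean,
          inner_zero_left, sum_const, nsmul_eq_mul]
        ring
    _ ≤ #S * ‖y - xs‖ ^ 2 + 2 * h ^ 2 *
          (#S * (α * (4 * L * ((P y - P xs) + (P x - P xs))))) := by
        gcongr
        exact hvar.trans (by gcongr)
    _ = _ := by ring

end VarianceReduction

/-- Linear convergence of mS2GD (Theorem 1).
Epochs are indexed by `k`; the randomness of one epoch is an element of
`Ω = (Fin m → Finset (Fin n)) × Fin m`, i.e. the `m` mini-batches `A_{k,0},…,A_{k,m−1}`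
together with the stopping index `T_k` (`T_k = (snd) + 1` is uniform on `{1,…,m}`).
`X k ω` is the iterate `x_k` as a function of the (independent, uniform) randomness
`ω : Fin k → Ω` of the first `k` epochs, and `Y k ω` is the inner-loop sequence of epoch `k`.
Then `E[P(x_k) − P(x*)] ≤ ρ^k (P(x₀) − P(x*))`. -/
theorem mS2GD_linear_convergence (d n : ℕ) (hd : 1 ≤ d) (hn : 2 ≤ n)
    (f : Fin n → EuclideanSpace ℝ (Fin d) → ℝ)
    (f' : Fin n → EuclideanSpace ℝ (Fin d) → EuclideanSpace ℝ (Fin d))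
    (L : ℝ) (hL : 0 < L)
    (hconv : ∀ i, ConvexOn ℝ Set.univ (f i))
    (hgrad : ∀ i x, HasGradientAt (f i) (f' i x) x)
    (hlip : ∀ i x y, ‖f' i x - f' i y‖ ≤ L * ‖x - y‖)
    (F : EuclideanSpace ℝ (Fin d) → ℝ) (hF : ∀ x, F x = (n : ℝ)⁻¹ * ∑ i, f i x)
    (R : EuclideanSpace ℝ (Fin d) → ℝ) (hRconv : ConvexOn ℝ Set.univ R)
    (hRcont : Continuous R)
    (P : EuclideanSpace ℝ (Fin d) → ℝ) (hP : ∀ x, P x = F x + R x)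
    (μ : ℝ) (hμ : 0 < μ)
    (hstrong : ConvexOn ℝ Set.univ (fun x => P x - μ / 2 * ‖x‖ ^ 2))
    (xstar : EuclideanSpace ℝ (Fin d)) (hxstar : ∀ x, P xstar ≤ P x)
    (m : ℕ) (hm : 1 ≤ m)
    (b : ℕ) (hb1 : 1 ≤ b) (hbn : b ≤ n)
    (α : ℝ) (hα : α = ((n : ℝ) - (b : ℝ)) / ((b : ℝ) * ((n : ℝ) - 1)))
    (h : ℝ) (hh0 : 0 < h) (hhL : h ≤ 1 / L) (hsmall : 4 * h * L * α < 1)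
    (ρ : ℝ) (hρ : ρ = 1 / ((m : ℝ) * h * μ * (1 - 4 * h * L * α))
        + 4 * h * L * α * ((m : ℝ) + 1) / ((m : ℝ) * (1 - 4 * h * L * α)))
    (hρ1 : ρ < 1)
    (prox : EuclideanSpace ℝ (Fin d) → EuclideanSpace ℝ (Fin d))
    (hprox : ∀ z w, (1 / 2) * ‖prox z - z‖ ^ 2 + h * R (prox z)
        ≤ (1 / 2) * ‖w - z‖ ^ 2 + h * R w)
    (x0 : EuclideanSpace ℝ (Fin d))
    (X : (k : ℕ) → (Fin k → (Fin m → Finset (Fin n)) × Fin m) →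
        EuclideanSpace ℝ (Fin d))
    (Y : (k : ℕ) → (Fin (k + 1) → (Fin m → Finset (Fin n)) × Fin m) → ℕ →
        EuclideanSpace ℝ (Fin d))
    (hX0 : ∀ ω, X 0 ω = x0)
    (hY0 : ∀ k (ω : Fin (k + 1) → (Fin m → Finset (Fin n)) × Fin m),
        Y k ω 0 = X k (fun i => ω i.castSucc))
    (hYs : ∀ k (ω : Fin (k + 1) → (Fin m → Finset (Fin n)) × Fin m) (t : Fin m),
        Y k ω (t.val + 1) =
          prox (Y k ω t.val - h •
            (((n : ℝ)⁻¹ • ∑ i, f' i (X k (fun i => ω i.castSucc)))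
              + (b : ℝ)⁻¹ • ∑ i ∈ (ω (Fin.last k)).1 t,
                  (f' i (Y k ω t.val) - f' i (X k (fun i => ω i.castSucc))))))
    (hXs : ∀ k (ω : Fin (k + 1) → (Fin m → Finset (Fin n)) × Fin m),
        X (k + 1) ω = Y k ω ((ω (Fin.last k)).2.val + 1)) :
    ∀ k : ℕ,
      ((((Fintype.piFinset (fun _ : Fin m =>
            Finset.powersetCard b (Finset.univ : Finset (Fin n)))) ×ˢ
            (Finset.univ : Finset (Fin m))).card : ℝ) ^ k)⁻¹ *
        ∑ ω ∈ Fintype.piFinset (fun _ : Fin k =>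
            (Fintype.piFinset (fun _ : Fin m =>
              Finset.powersetCard b (Finset.univ : Finset (Fin n)))) ×ˢ
              (Finset.univ : Finset (Fin m))),
          (P (X k ω) - P xstar)
      ≤ ρ ^ k * (P x0 - P xstar) := by
  have hS : (Finset.powersetCard b (Finset.univ : Finset (Fin n))).Nonempty :=
    Finset.powersetCard_nonempty.2 (by simpa using hbn)
  set S := Finset.powersetCard b (Finset.univ : Finset (Fin n))
  set Q := Fintype.piFinset (fun _ : Fin m => S) with hQ
  have hQpos : (0 : ℝ) < Q.card := by
    exact_mod_cast (Fintype.piFinset_nonempty.2 fun _ => hS).card_pos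
  have hmpos : (0 : ℝ) < m := by exact_mod_cast hm
  have hα0 : 0 ≤ α := by
    have h1 : (2 : ℝ) ≤ n := by exact_mod_cast hn
    have h2 : (b : ℝ) ≤ n := by exact_mod_cast hbn
    exact hα ▸ div_nonneg (by linarith) (mul_nonneg (Nat.cast_nonneg b) (by linarith))
  have hgap : 0 < 1 - 4 * h * L * α := by linarith
  have hρ0 : 0 ≤ ρ := by
    rw [hρ]
    positivity
  have hcard : ((Q ×ˢ (Finset.univ : Finset (Fin m))).card : ℝ) = Q.card * m := by
    rw [Finset.card_product, Finset.card_univ, Fintype.card_fin, Nat.cast_mul]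
  have hhL' : h * L ≤ 1 := (le_div_iff₀ hL).1 hhL
  have hf (i : Fin n) : IsSmoothConvex (f i) (f' i) L :=
    isSmoothConvex_of_hasGradientAt (hconv i) (hgrad i) (hlip i)
  have hP' (x) : P x = (n : ℝ)⁻¹ * ∑ i, f i x + R x := by rw [hP, hF]
  have hepoch (k : ℕ) (ω : Fin k → (Fin m → Finset (Fin n)) × Fin m) :
      ∑ a ∈ Q ×ˢ (Finset.univ : Finset (Fin m)),
          (P (X (k + 1) (Fin.snoc (α := fun _ => (Fin m → Finset (Fin n)) × Fin m) ω a)) - P xstar)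
        ≤ Q.card * m * (ρ * (P (X k ω) - P xstar)) := by
    let x := X k ω
    let j₀ : Fin m := ⟨0, hm⟩
    let step : EuclideanSpace ℝ (Fin d) → Finset (Fin n) → EuclideanSpace ℝ (Fin d) :=
      fun z B => prox (z - h • ((n : ℝ)⁻¹ • ∑ i, f' i x
        + (b : ℝ)⁻¹ • ∑ i ∈ B, (f' i z - f' i x)))
    let y : (Fin m → Finset (Fin n)) → Fin m → ℕ → EuclideanSpace ℝ (Fin d) := fun A j =>
      Y k (Fin.snoc (α := fun _ => (Fin m → Finset (Fin n)) × Fin m) ω (A, j))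
    have hy0 (A j) : y A j 0 = x := by simp [y, x, hY0]
    have hys (A j) (t : Fin m) : y A j (t + 1) = step (y A j t) (A t) := by
      simp [y, x, step, hYs]
    have hyj (A j) (t : ℕ) (ht : t ≤ m) : y A j t = y A j₀ t := by
      induction t with
      | zero => rw [hy0, hy0]
      | succ t ih =>
        rw [hys A j ⟨t, ht⟩, hys A j₀ ⟨t, ht⟩, ih (by omega)]
    have hsum : ∑ a ∈ Q ×ˢ (Finset.univ : Finset (Fin m)),
          (P (X (k + 1) (Fin.snoc (α := fun _ => (Fin m → Finset (Fin n)) × Fin m) ω a)) - P xstar)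
        = ∑ A ∈ Q, ∑ j : Fin m, (P (y A j₀ (j + 1)) - P xstar) := by
      rw [Finset.sum_product]
      refine Finset.sum_congr rfl fun A _ => Finset.sum_congr rfl fun j _ => ?_
      rw [hXs, Fin.snoc_last, ← hyj A j _ j.isLt]
    have hle := sum_epoch_le S hS (h := h) (c := 8 * h ^ 2 * L * α) (by positivity)
      (fun z => ‖z - xstar‖ ^ 2) (fun z => P z - P xstar) (fun _ => sq_nonneg _)
      (fun z => sub_nonneg.2 (hxstar z)) x step
      (fun z => hα ▸ sum_powersetCard_prox_step_le hn hb1 hbn hL hf hRconv hP' hxstar hh0 hhL'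
        hprox x z (step z) fun _ => rfl)
      (fun A => y A j₀) (fun A => hy0 A j₀) (fun A => hys A j₀)
    rw [← hQ, ← hsum] at hle
    have hdist : ‖x - xstar‖ ^ 2 ≤ 2 / μ * (P x - P xstar) := by
      have := norm_sub_sq_le_of_isMin hstrong hxstar x
      rw [div_mul_eq_mul_div, le_div_iff₀ hμ]
      linarith
    have hpos : 0 < 2 * h - 8 * h ^ 2 * L * α := by
      have : 2 * h - 8 * h ^ 2 * L * α = 2 * h * (1 - 4 * h * L * α) := by ring
      rw [this]
      positivity
    refine le_of_mul_le_mul_left (hle.trans ?_) hpos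
    have hρe : (2 * h - 8 * h ^ 2 * L * α) * (m * ρ)
        = 2 / μ + 8 * h ^ 2 * L * α * (m + 1) := by
      have hne := hgap.ne'
      rw [hρ]
      generalize hδ : 1 - 4 * h * L * α = δ at hne ⊢
      have : 2 * h - 8 * h ^ 2 * L * α = 2 * h * δ := by rw [← hδ]; ring
      rw [this]
      field_simp
      ring
    calc (Q.card : ℝ) * (‖x - xstar‖ ^ 2 + 8 * h ^ 2 * L * α * (m + 1) * (P x - P xstar))
        ≤ Q.card * (2 / μ * (P x - P xstar)
          + 8 * h ^ 2 * L * α * (m + 1) * (P x - P xstar)) := by gcongr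
      _ = Q.card * (((2 * h - 8 * h ^ 2 * L * α) * (m * ρ)) * (P x - P xstar)) := by
          rw [hρe]; ring
      _ = _ := by ring
  intro k
  rw [hcard, inv_mul_le_iff₀ (by positivity)]
  induction k with
  | zero => simp [hX0]
  | succ k ih =>
    rw [sum_piFinset_snoc]
    calc _ ≤ ∑ ω ∈ Fintype.piFinset (fun _ : Fin k => Q ×ˢ (Finset.univ : Finset (Fin m))),
            Q.card * m * (ρ * (P (X k ω) - P xstar)) :=
          Finset.sum_le_sum fun ω _ => hepoch k ω
      _ = Q.card * m * ρ * ∑ ω ∈ Fintype.piFinset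
            (fun _ : Fin k => Q ×ˢ (Finset.univ : Finset (Fin m))), (P (X k ω) - P xstar) := by
          rw [Finset.mul_sum]
          exact Finset.sum_congr rfl fun ω _ => by ring
      _ ≤ Q.card * m * ρ * ((Q.card * m) ^ k * (ρ ^ k * (P x0 - P xstar))) := by gcongr
      _ = _ := by ring
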